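/- Let F be a 3-CNF formula over n Boolean variables and S' the indeterminate string over {0,1,$} constructed from F for the absent-word reduction as described. If a bitstring B ∈ {0,1}^n encodes an assignment satisfying F, then B is a minimal absent word (MAW) of S': B is absent from S' and every proper substring of B occurs in S'. -/

import Mathlib

/-- A 3-clause over Boolean variables `x_0, …, x_{n-1}`: it consists of three
literals on three distinct variables `a < b < c`; the Booleans `na`, `nb`, `nc`
record whether the respective literal is negated (so, in the paper's notation,
`v_a = na`, `v_b = nb`, `v_c = nc`, reading the bit `0` as `false` and `1` as `true`). -/
structure Clause3 (n : ℕ) where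
  a : Fin n
  b : Fin n
  c : Fin n
  hab : a < b
  hbc : b < c
  na : Bool
  nb : Bool
  nc : Bool

/-- The clause `C` is satisfied by the assignment `σ`:
some literal of `C` evaluates to true. -/
def Clause3.Sat {n : ℕ} (C : Clause3 n) (σ : Fin n → Bool) : Prop :=
  σ C.a ≠ C.na ∨ σ C.b ≠ C.nb ∨ σ C.c ≠ C.nc

/-- The language of an indeterminate string `S` (a list of nonempty sets of
characters): all classic strings of the same length as `S` choosing, at each
position, a character of the corresponding symbol. -/
def Lang {α : Type*} (S : List (Set α)) : Set (List α) :=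
  {X | List.Forall₂ (fun x A => x ∈ A) X S}

/-- The classic string `P` occurs in the indeterminate string `S` at
(0-based) position `i`: some `X ∈ L(S)` has `P` as the substring of
length `|P|` starting at position `i`. -/
def OccursAt {α : Type*} (S : List (Set α)) (P : List α) (i : ℕ) : Prop :=
  ∃ X ∈ Lang S, (X.drop i).take P.length = P

/-- We model the alphabet `{0, 1, $}` as `Option Bool`:
`some false` is `0`, `some true` is `1`, and `none` is `$`. -/
abbrev OB := Option Bool

/-- The symbol `{0, 1}`. -/
def bitSym : Set OB := {some false, some true}

/-- The symbol `{$}`. -/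
def dolSym : Set OB := {none}

/-- The symbol `{0, 1, $}`. -/
def triSym : Set OB := {some false, some true, none}

/-- The indeterminate string `T_j` (over `{0,1}`, here embedded into `{0,1,$}`)
built from the clause `C = C_j`: position `a` carries `{v_a}`, position `b`
carries `{v_b}`, position `c` carries `{v_c}`, every other position carries `{0,1}`. -/
def clauseStr (n : ℕ) (C : Clause3 n) : List (Set OB) :=
  (List.finRange n).map fun i =>
    if i = C.a then {some C.na}
    else if i = C.b then {some C.nb}
    else if i = C.c then {some C.nc}
    else bitSym

/-- The indeterminate string
`S = T_1 · {$} · … · {$} · T_m · {$} · {0,1}^n · {$} · {0,1}^{n-1} · {$} · {0,1}^{n-1}`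
of the MUS reduction. -/
def musS (n : ℕ) (F : List (Clause3 n)) : List (Set OB) :=
  (F.map fun C => clauseStr n C ++ [dolSym]).flatten ++
    List.replicate n bitSym ++ [dolSym] ++
    List.replicate (n - 1) bitSym ++ [dolSym] ++
    List.replicate (n - 1) bitSym

/-- The indeterminate string
`S' = T_1 · {$} · … · {$} · T_m · {$} · {0,1,$}^{n-1} · {$} · {0,1}^{n-1}`
of the MAW (absent word) reduction. -/
def mawS (n : ℕ) (F : List (Clause3 n)) : List (Set OB) :=
  (F.map fun C => clauseStr n C ++ [dolSym]).flatten ++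
    List.replicate (n - 1) triSym ++ [dolSym] ++
    List.replicate (n - 1) bitSym

/-- The bitstring (over `{0,1} ⊆ {0,1,$}`) of length `n` encoding the
assignment `σ`: its `i`-th character is `1` iff `σ i` is true. -/
def bits {n : ℕ} (σ : Fin n → Bool) : List OB :=
  List.ofFn fun i => some (σ i)

theorem aux_occ {n : ℕ} {S : List (Set OB)} {σ : Fin n → Bool} {i : ℕ}
    (h : OccursAt S (bits σ) i) (k : ℕ) (hk : k < n) :
    ∃ A, S[i+k]? = some A ∧ some (σ ⟨k, hk⟩) ∈ A := by
  obtain ⟨X, hX, hP⟩ := h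
  have hX' : List.Forall₂ (fun x A => x ∈ A) X S := hX
  have h1 : ((X.drop i).take (bits σ).length)[k]? = some (some (σ ⟨k, hk⟩)) := by
    rw [hP]; simp [bits, hk]
  have h2 : X[i+k]? = some (some (σ ⟨k, hk⟩)) := by
    rw [List.getElem?_take] at h1
    simpa [bits, hk] using h1
  obtain ⟨hl, he⟩ := List.getElem?_eq_some_iff.1 h2
  have hlen := hX'.length_eq
  have := (List.forall₂_iff_get.1 hX').2 (i+k) hl (hlen ▸ hl)
  refine ⟨S[i+k]'(hlen ▸ hl), by simp, ?_⟩
  rw [← he]; simpa using this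

theorem aux_absent (n : ℕ) (hn : 0 < n) (σ : Fin n → Bool) (F : List (Clause3 n))
    (hσ : ∀ C ∈ F, C.Sat σ) : ∀ i : ℕ,
    ¬ ∀ (k : ℕ) (hk : k < n), ∃ A, (mawS n F)[i+k]? = some A ∧ some (σ ⟨k, hk⟩) ∈ A := by
  induction F with
  | nil =>
    intro i h
    by_cases hi : i ≤ n - 1
    · obtain ⟨A, h1, h2⟩ := h (n - 1 - i) (by omega)
      have : i + (n - 1 - i) = n - 1 := by omega
      rw [this] at h1
      simp [mawS] at h1
      subst h1
      simp [dolSym] at h2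
    · obtain ⟨A, h1, h2⟩ := h (n - 1) (by omega)
      obtain ⟨hl, _⟩ := List.getElem?_eq_some_iff.1 h1
      simp [mawS] at hl
      omega
  | cons C F ih =>
    intro i h
    have hS : mawS n (C :: F) = clauseStr n C ++ (dolSym :: mawS n F) := by
      simp [mawS]
    have hL : (clauseStr n C).length = n := by simp [clauseStr]
    rw [hS] at h
    by_cases hi0 : i = 0
    · subst hi0
      have key : ∀ j : Fin n, some (σ j) ∈ (if j = C.a then ({some C.na} : Set OB)
          else if j = C.b then {some C.nb}
          else if j = C.c then {some C.nc}
          else bitSym) := by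
        intro j
        obtain ⟨A, h1, h2⟩ := h j j.2
        rw [List.getElem?_append_left (by rw [hL]; omega)] at h1
        simp [clauseStr] at h1
        rw [h1]; exact h2
      have ha := key C.a
      have hb := key C.b
      have hc := key C.c
      have h1 := C.hab
      have h2 := C.hbc
      have h3 := h1.trans h2
      simp [h1.ne'] at hb
      simp [h2.ne', h3.ne'] at hc
      simp at ha
      rcases hσ C (by simp) with h | h | h <;> contradiction
    · by_cases hi : i ≤ n
      · obtain ⟨A, h1, h2⟩ := h (n - i) (by omega)
        rw [List.getElem?_append_right (by omega), hL] at h1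
        have : i + (n - i) - n = 0 := by omega
        rw [this] at h1
        simp at h1
        subst h1
        simp [dolSym] at h2
      · refine ih (fun C hC => hσ C (by simp [hC])) (i - (n + 1)) ?_
        intro k hk
        obtain ⟨A, h1, h2⟩ := h k hk
        rw [List.getElem?_append_right (by omega), hL] at h1
        have : i + k - n = (i - (n + 1) + k) + 1 := by omega
        rw [this, List.getElem?_cons_succ] at h1
        exact ⟨A, h1, h2⟩

theorem aux_nonempty (S : List (Set OB)) (h : ∀ A ∈ S, A.Nonempty) :
    ∃ X, List.Forall₂ (fun x A => x ∈ A) X S := by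
  induction S with
  | nil => exact ⟨[], .nil⟩
  | cons A S ih =>
    obtain ⟨X, hX⟩ := ih (fun B hB => h B (by simp [hB]))
    obtain ⟨x, hx⟩ := h A (by simp)
    exact ⟨x :: X, .cons hx hX⟩

theorem aux_bit (Q : List OB) (h : ∀ q ∈ Q, q ∈ bitSym) :
    List.Forall₂ (fun x A => x ∈ A) Q (List.replicate Q.length bitSym) := by
  induction Q with
  | nil => exact .nil
  | cons q Q ih =>
    exact .cons (h q (by simp)) (ih fun x hx => h x (by simp [hx]))

theorem aux_pre (n : ℕ) (F : List (Clause3 n)) :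
    ∀ A ∈ (F.map fun C => clauseStr n C ++ [dolSym]).flatten ++
      List.replicate (n - 1) triSym ++ [dolSym], A.Nonempty := by
  have hd : dolSym.Nonempty := ⟨none, rfl⟩
  have ht : triSym.Nonempty := ⟨none, by simp [triSym]⟩
  have hb : bitSym.Nonempty := ⟨some true, by simp [bitSym]⟩
  intro A hA
  simp only [List.mem_append, List.mem_flatten, List.mem_map, List.mem_singleton] at hA
  rcases hA with (⟨l, ⟨C, _, rfl⟩, hA⟩ | hA) | rfl
  · rcases List.mem_append.1 hA with hA | hA
    · simp only [clauseStr, List.mem_map] at hA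
      obtain ⟨i, _, rfl⟩ := hA
      split_ifs <;> first | exact hb | exact Set.singleton_nonempty _
    · rw [List.mem_singleton.1 hA]; exact hd
  · rw [List.eq_of_mem_replicate hA]; exact ht
  · exact hd

/-- If the bitstring `B = bits σ ∈ {0,1}^n` encodes an assignment
`σ` satisfying `F`, then `B` is a minimal absent word (MAW) of `S'`:
`B` is absent from `S'` and every proper substring of `B` occurs in `S'`. -/
theorem satisfying_bitstring_is_MAW
    (n : ℕ) (hn : 0 < n) (F : List (Clause3 n)) (σ : Fin n → Bool)
    (hσ : ∀ C ∈ F, C.Sat σ) :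
    (¬ ∃ i : ℕ, OccursAt (mawS n F) (bits σ) i) ∧
    (∀ Q : List OB, Q <:+: bits σ → Q ≠ bits σ →
      ∃ i : ℕ, OccursAt (mawS n F) Q i) := by
  refine ⟨fun ⟨i, h⟩ => aux_absent n hn σ F hσ i (aux_occ h), ?_⟩
  intro Q hQ hne
  have hlen : Q.length < n := by
    have h1 : (bits σ).length = n := by simp [bits]
    have h2 := hQ.length_le
    rcases Nat.lt_or_ge Q.length n with h | h
    · exact h
    · exact absurd (hQ.eq_of_length (by omega)) hne
  obtain ⟨Y, hY⟩ := aux_nonempty _ (aux_pre n F)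
  have hR := aux_bit (Q ++ List.replicate (n - 1 - Q.length) (some false)) (by
    intro q hq
    rcases List.mem_append.1 hq with hq | hq
    · have := hQ.subset hq
      simp only [bits, List.mem_ofFn] at this
      obtain ⟨i, rfl⟩ := this
      cases σ i <;> simp [bitSym]
    · rw [List.eq_of_mem_replicate hq]; simp [bitSym])
  have hl : (Q ++ List.replicate (n - 1 - Q.length) (some false)).length = n - 1 := by
    simp; omega
  rw [hl] at hR
  refine ⟨Y.length, Y ++ (Q ++ List.replicate (n - 1 - Q.length) (some false)), ?_, by simp⟩
  exact List.rel_append hY hR
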